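/- For every natural number n ≥ 1 and every λ > 0 there exists a function π : [0,∞) → (0,∞) of class C^{1,1} (i.e. differentiable with Lipschitz continuous derivative) such that: (i) π(t)^{n−1}·(π(t) + t·π'(t)) ≤ 1 for all t ≥ 0; (ii) π(t)^{n−1}·(π(t) + t·π'(t)) < 1 for all t ≥ 2λ; (iii) π(t) = 1 for all t ∈ [0, λ]; (iv) sup_{t ≥ 0} π(t) ≤ C for a constant C depending only on n and not on λ; and (v) sup_{t ≥ 0} |π'(t)| ≤ C(λ) for some constant C(λ) < ∞. -/

import Mathlib

open Set

/-- The square of the positive part is differentiable, with derivative twice the positive part. -/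
lemma hasDerivAt_sq_max_zero (x : ℝ) :
    HasDerivAt (fun y : ℝ => max y 0 ^ 2) (2 * max x 0) x := by
  rw [hasDerivAt_iff_isLittleO]
  refine Asymptotics.IsBigO.trans_isLittleO (g := fun y => ‖y - x‖ ^ 2) ?_
    (Asymptotics.isLittleO_pow_sub_sub x one_lt_two)
  refine Asymptotics.IsBigO.of_bound 1 (Filter.Eventually.of_forall fun y => ?_)
  simp only [smul_eq_mul, Real.norm_eq_abs, one_mul]
  rw [sq_abs, abs_of_nonneg (sq_nonneg (y - x)), abs_le]
  rcases max_cases x 0 with ⟨h, h'⟩ | ⟨h, h'⟩ <;> rcases max_cases y 0 with ⟨k, k'⟩ | ⟨k, k'⟩ <;>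
    rw [h, k] <;> constructor <;> nlinarith

/-- The function `x ↦ 2x / (1 + x²)²` is Lipschitz. -/
lemma lipschitzWith_two_mul_div_sq :
    LipschitzWith 6 (fun x : ℝ => 2 * x / (1 + x ^ 2) ^ 2) := by
  have hd (x : ℝ) : HasDerivAt (fun x : ℝ => 2 * x / (1 + x ^ 2) ^ 2)
      ((2 - 6 * x ^ 2) / (1 + x ^ 2) ^ 3) x := by
    have h0 : 1 + x ^ 2 ≠ 0 := by positivity
    have hden : HasDerivAt (fun x : ℝ => (1 + x ^ 2) ^ 2) (2 * (1 + x ^ 2) * (2 * x)) x := by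
      simpa using ((hasDerivAt_pow 2 x).const_add 1).fun_pow 2
    refine (((hasDerivAt_id' x).const_mul 2).fun_div hden (pow_ne_zero 2 h0)).congr_deriv ?_
    field_simp
    ring
  refine lipschitzWith_of_nnnorm_deriv_le (fun x => (hd x).differentiableAt) fun x => ?_
  rw [(hd x).deriv, ← NNReal.coe_le_coe, coe_nnnorm, Real.norm_eq_abs, abs_div,
    abs_of_pos (show (0 : ℝ) < (1 + x ^ 2) ^ 3 by positivity), div_le_iff₀ (by positivity)]
  have h1 : 1 + x ^ 2 ≤ (1 + x ^ 2) ^ 3 :=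
    le_self_pow₀ (by nlinarith [sq_nonneg x]) (by norm_num)
  simp only [NNReal.coe_ofNat]
  rw [abs_le]
  constructor <;> nlinarith [sq_nonneg x]

/-- **Lemma A.2.**  For every `n ≥ 1` there is a constant `C` (independent of `λ`) such
that for every `λ > 0` there is a `C^{1,1}` function `π : [0,∞) → (0,∞)` (with derivative
`P`, Lipschitz on `[0,∞)`) satisfying `π(t)^{n-1}(π(t) + t π'(t)) ≤ 1` for all `t ≥ 0`,
with strict inequality for `t ≥ 2λ`, `π ≡ 1` on `[0,λ]`, `sup π ≤ C`, and
`sup |π'| ≤ C(λ) < ∞`. -/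
theorem exists_auxiliary_function_pi (n : ℕ) (hn : 1 ≤ n) :
    ∃ C : ℝ, 0 < C ∧
      ∀ lam : ℝ, 0 < lam →
        ∃ (π P : ℝ → ℝ) (K : NNReal),
          (∀ t ∈ Ici (0 : ℝ), 0 < π t) ∧
          (∀ t ∈ Ici (0 : ℝ), HasDerivWithinAt π (P t) (Ici 0) t) ∧
          LipschitzOnWith K P (Ici 0) ∧
          (∀ t : ℝ, 0 ≤ t → π t ^ (n - 1) * (π t + t * P t) ≤ 1) ∧
          (∀ t : ℝ, 2 * lam ≤ t → π t ^ (n - 1) * (π t + t * P t) < 1) ∧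
          (∀ t ∈ Icc (0 : ℝ) lam, π t = 1) ∧
          (∀ t : ℝ, 0 ≤ t → π t ≤ C) ∧
          (∃ Clam : ℝ, ∀ t : ℝ, 0 ≤ t → |P t| ≤ Clam) := by
  refine ⟨1, one_pos, fun lam hlam => ?_⟩
  set s : ℝ → ℝ := fun t => max (t - lam) 0 with hs
  have hs0 (t : ℝ) : 0 ≤ s t := le_max_right _ _
  set π : ℝ → ℝ := fun t => (1 + s t ^ 2)⁻¹ with hπ
  set P : ℝ → ℝ := fun t => -(2 * s t / (1 + s t ^ 2) ^ 2) with hP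
  have hpos (t : ℝ) : 0 < π t := by simp only [hπ]; positivity
  have hle (t : ℝ) : π t ≤ 1 := inv_le_one_of_one_le₀ (by nlinarith [sq_nonneg (s t)])
  have hPle (t : ℝ) : P t ≤ 0 := by
    have := hs0 t
    simp only [hP, Left.neg_nonpos_iff]
    positivity
  have hmain (t : ℝ) (ht : 0 ≤ t) : π t ^ (n - 1) * (π t + t * P t) ≤ π t := by
    have h1 : π t ^ (n - 1) ≤ 1 := pow_le_one₀ (hpos t).le (hle t)
    calc π t ^ (n - 1) * (π t + t * P t) ≤ π t ^ (n - 1) * π t := by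
          have := (hpos t).le
          gcongr
          linarith [mul_nonpos_of_nonneg_of_nonpos ht (hPle t)]
      _ ≤ π t := mul_le_of_le_one_left (hpos t).le h1
  have hlip : LipschitzWith 6 P := by
    have hsl : LipschitzWith 1 s := by
      simpa using (LipschitzWith.id.sub (LipschitzWith.const lam)).max_const 0
    have h := (lipschitzWith_two_mul_div_sq.comp hsl).neg
    rw [mul_one] at h
    exact h
  refine ⟨π, P, 6, fun t _ => hpos t, fun t _ => HasDerivAt.hasDerivWithinAt ?_,
    hlip.lipschitzOnWith, fun t ht => (hmain t ht).trans (hle t), fun t ht => ?_,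
    fun t ht => ?_, fun t _ => hle t, 1, fun t _ => ?_⟩
  · have h := (((hasDerivAt_sq_max_zero (t - lam)).comp_sub_const t lam).const_add 1).inv
      (by positivity)
    rw [neg_div] at h
    exact h
  · refine (hmain t (by linarith)).trans_lt (inv_lt_one_of_one_lt₀ ?_)
    have : 0 < s t := lt_max_of_lt_left (by linarith)
    nlinarith
  · have : s t = 0 := max_eq_right (by linarith [ht.2])
    simp [hπ, this]
  · have := hs0 t
    rw [hP, abs_neg, abs_of_nonneg (by positivity), div_le_one (by positivity)]
    nlinarith [sq_nonneg (s t - 1), sq_nonneg (s t), sq_nonneg (s t ^ 2)]
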